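/- Let (x*,λ*) be a saddle point of L, assume β(t) ≡ β > 0 is constant and γδ > 1, and let (x,λ) be a global solution of the primal-dual dynamical system. Define the ergodic average x̄(t) = (1/(t − t₀)) ∫_{t₀}^{t} x(s) ds for t > t₀. Then |f(x̄(t)) − f(x*)| = O(1/t) as t → ∞, i.e., there exist C ≥ 0 and T > t₀ such that |f(x̄(t)) − f(x*)| ≤ C/t for all t ≥ T. -/

import Mathlib

open scoped RealInnerProductSpace
open MeasureTheory Set

noncomputable def Lagr {n m : ℕ} (f : EuclideanSpace ℝ (Fin n) → ℝ)
    (A : EuclideanSpace ℝ (Fin n) →L[ℝ] EuclideanSpace ℝ (Fin m))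
    (b : EuclideanSpace ℝ (Fin m))
    (x : EuclideanSpace ℝ (Fin n)) (lam : EuclideanSpace ℝ (Fin m)) : ℝ :=
  f x + ⟪lam, A x - b⟫

noncomputable def AugLagr {n m : ℕ} (f : EuclideanSpace ℝ (Fin n) → ℝ)
    (A : EuclideanSpace ℝ (Fin n) →L[ℝ] EuclideanSpace ℝ (Fin m))
    (b : EuclideanSpace ℝ (Fin m)) (σ : ℝ)
    (x : EuclideanSpace ℝ (Fin n)) (lam : EuclideanSpace ℝ (Fin m)) : ℝ :=
  Lagr f A b x lam + σ / 2 * ‖A x - b‖ ^ 2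

def IsSaddlePoint {n m : ℕ} (f : EuclideanSpace ℝ (Fin n) → ℝ)
    (A : EuclideanSpace ℝ (Fin n) →L[ℝ] EuclideanSpace ℝ (Fin m))
    (b : EuclideanSpace ℝ (Fin m))
    (xs : EuclideanSpace ℝ (Fin n)) (ls : EuclideanSpace ℝ (Fin m)) : Prop :=
  ∀ x lam, Lagr f A b xs lam ≤ Lagr f A b xs ls ∧ Lagr f A b xs ls ≤ Lagr f A b x ls

lemma ConvexOn.add_inner_gradient_le {F : Type*} [NormedAddCommGroup F] [InnerProductSpace ℝ F]
    [CompleteSpace F] {f : F → ℝ} (hf : ConvexOn ℝ univ f) {g x : F} (hg : HasGradientAt f g x)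
    (y : F) : f x + ⟪g, y - x⟫ ≤ f y := by
  have hline : HasDerivAt (fun s : ℝ => AffineMap.lineMap x y s) (y - x) 0 :=
    AffineMap.hasDerivAt_lineMap
  have hderiv : HasDerivAt (f ∘ fun s : ℝ => AffineMap.lineMap x y s) ⟪g, y - x⟫ 0 := by
    have hg' := hg.hasFDerivAt
    rw [← AffineMap.lineMap_apply_zero (k := ℝ) x y] at hg'
    simpa using hg'.comp_hasDerivAt (0 : ℝ) hline
  have hconv : ConvexOn ℝ univ (f ∘ fun s : ℝ => AffineMap.lineMap x y s) := by
    simpa using hf.comp_affineMap (AffineMap.lineMap x y : ℝ →ᵃ[ℝ] F)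
  have h := hconv.le_slope_of_hasDerivAt (mem_univ 0) (mem_univ 1) one_pos hderiv
  simp [slope_def_field] at h
  linarith

lemma ContinuousOn.hasDerivWithinAt_integral_Ici {F : Type*} [NormedAddCommGroup F]
    [NormedSpace ℝ F] [CompleteSpace F] {x : ℝ → F} {a : ℝ} (hx : ContinuousOn x (Ici a)) {t : ℝ}
    (ht : t ∈ Ici a) :
    HasDerivWithinAt (fun u => ∫ s in a..u, x s) (x t) (Ici a) t := by
  have hcont : Continuous fun s => x (max s a) :=
    hx.comp_continuous (by fun_prop) fun s => le_max_right s a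
  have hmax : ∀ s ∈ Ici a, x (max s a) = x s := fun s hs => by rw [max_eq_left hs]
  have h := (hcont.integral_hasStrictDerivAt a t).hasDerivAt.hasDerivWithinAt (s := Ici a)
  rw [hmax t ht] at h
  refine h.congr_of_mem (fun u hu => intervalIntegral.integral_congr fun s hs => ?_) ht
  rw [uIcc_of_le hu] at hs
  exact (hmax s hs.1).symm

lemma antitoneOn_Ici_of_hasDerivWithinAt_nonpos {F F' : ℝ → ℝ} {a : ℝ}
    (hF : ∀ t ∈ Ici a, HasDerivWithinAt F (F' t) (Ici a) t) (hF' : ∀ t ∈ Ici a, F' t ≤ 0) :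
    AntitoneOn F (Ici a) :=
  antitoneOn_of_hasDerivWithinAt_nonpos (convex_Ici a) (fun t ht => (hF t ht).continuousWithinAt)
    (fun t ht => (hF t (interior_subset ht)).mono interior_subset)
    fun t ht => hF' t (interior_subset ht)

section PrimalDual

variable {n m : ℕ} {f : EuclideanSpace ℝ (Fin n) → ℝ}
  {A : EuclideanSpace ℝ (Fin n) →L[ℝ] EuclideanSpace ℝ (Fin m)} {b : EuclideanSpace ℝ (Fin m)}
  {xs : EuclideanSpace ℝ (Fin n)} {ls : EuclideanSpace ℝ (Fin m)}

lemma IsSaddlePoint.map_eq (h : IsSaddlePoint f A b xs ls) : A xs = b := by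
  have h1 := (h xs (ls + (A xs - b))).1
  simp only [Lagr, inner_add_left, real_inner_self_eq_norm_sq] at h1
  have h2 : ‖A xs - b‖ = 0 := by
    nlinarith [norm_nonneg (A xs - b)]
  exact sub_eq_zero.1 (norm_eq_zero.1 h2)

lemma IsSaddlePoint.le_lagr (h : IsSaddlePoint f A b xs ls) (x : EuclideanSpace ℝ (Fin n)) :
    f xs ≤ Lagr f A b x ls := by
  have h1 := (h x ls).2
  rwa [Lagr, h.map_eq, sub_self, inner_zero_right, add_zero] at h1

/-- The Lyapunov function of the primal-dual dynamical system with constant `β`. -/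
noncomputable def lyapunov (f : EuclideanSpace ℝ (Fin n) → ℝ)
    (A : EuclideanSpace ℝ (Fin n) →L[ℝ] EuclideanSpace ℝ (Fin m)) (b : EuclideanSpace ℝ (Fin m))
    (γ δ σ β : ℝ) (xs : EuclideanSpace ℝ (Fin n)) (ls : EuclideanSpace ℝ (Fin m))
    (x v : EuclideanSpace ℝ (Fin n)) (lam : EuclideanSpace ℝ (Fin m)) : ℝ :=
  1 / 2 * ‖x - xs + δ • v‖ ^ 2 + (γ * δ - 1) / 2 * ‖x - xs‖ ^ 2
    + δ ^ 2 * β * (AugLagr f A b σ x ls - f xs) + δ / 2 * ‖lam - ls‖ ^ 2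

lemma hasDerivWithinAt_augLagr {σ : ℝ} {x : ℝ → EuclideanSpace ℝ (Fin n)}
    {v g : EuclideanSpace ℝ (Fin n)} {s : Set ℝ} {t : ℝ}
    (hg : HasGradientAt f g (x t)) (hx : HasDerivWithinAt x v s t) :
    HasDerivWithinAt (fun t => AugLagr f A b σ (x t) ls)
      (⟪g, v⟫ + ⟪ls, A v⟫ + σ * ⟪A (x t) - b, A v⟫) s t := by
  have hf : HasDerivWithinAt (fun t => f (x t)) ⟪g, v⟫ s t := by
    simpa [Function.comp_def] using hg.hasFDerivAt.comp_hasDerivWithinAt t hx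
  have hA : HasDerivWithinAt (fun t => A (x t) - b) (A v) s t :=
    (A.hasFDerivAt.comp_hasDerivWithinAt t hx).sub_const b
  have h := (hf.add ((hasDerivWithinAt_const t s ls).inner ℝ hA)).add (hA.norm_sq.const_mul (σ / 2))
  refine h.congr_deriv ?_
  simp only [inner_zero_left]
  ring

lemma hasDerivWithinAt_lyapunov {γ δ σ β : ℝ} {x x' : ℝ → EuclideanSpace ℝ (Fin n)}
    {lam : ℝ → EuclideanSpace ℝ (Fin m)} {g a : EuclideanSpace ℝ (Fin n)}
    {μ : EuclideanSpace ℝ (Fin m)} {s : Set ℝ} {t : ℝ} (hxs : A xs = b)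
    (hg : HasGradientAt f g (x t)) (hx : HasDerivWithinAt x (x' t) s t)
    (hx' : HasDerivWithinAt x' a s t) (hlam : HasDerivWithinAt lam μ s t)
    (ha : a + γ • x' t = -β • (g + A.adjoint (lam t) + σ • A.adjoint (A (x t) - b)))
    (hμ : μ = β • (A (x t + δ • x' t) - b)) :
    HasDerivWithinAt (fun t => lyapunov f A b γ δ σ β xs ls (x t) (x' t) (lam t))
      (-(δ * (γ * δ - 1)) * ‖x' t‖ ^ 2
        - δ * β * (⟪g, x t - xs⟫ + ⟪ls, A (x t) - b⟫ + σ * ‖A (x t) - b‖ ^ 2)) s t := by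
  have hu := hx.sub_const xs
  have h := (((((hu.add (hx'.const_smul δ)).norm_sq.const_mul (1 / 2)).add
    (hu.norm_sq.const_mul ((γ * δ - 1) / 2))).add
    (((hasDerivWithinAt_augLagr (A := A) (b := b) (ls := ls) (σ := σ) hg hx).sub_const
      (f xs)).const_mul (δ ^ 2 * β))).add
    ((hlam.sub_const ls).norm_sq.const_mul (δ / 2)))
  refine h.congr_deriv ?_
  obtain rfl : a = -β • (g + A.adjoint (lam t) + σ • A.adjoint (A (x t) - b)) - γ • x' t :=
    eq_sub_of_add_eq ha
  have hAu : A (x t) - b = A (x t - xs) := by rw [map_sub, hxs]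
  have hAw : A (x t + δ • x' t) - b = A (x t - xs) + δ • A (x' t) := by
    rw [map_add, map_smul, ← hAu]; abel
  obtain ⟨ν, hν⟩ : ∃ ν, lam t = ls + ν := ⟨lam t - ls, by abel⟩
  subst hμ
  rw [hAw, hAu, hν]
  simp only [Pi.add_apply, Pi.smul_apply, add_sub_cancel_left]
  generalize x t - xs = u
  generalize x' t = v
  simp only [← real_inner_self_eq_norm_sq, inner_add_left, inner_add_right, inner_sub_right,
    inner_smul_left, inner_smul_right, ContinuousLinearMap.adjoint_inner_right, map_add,
    map_smul, smul_add, neg_smul, inner_neg_right, RCLike.conj_to_real]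
  rw [real_inner_comm g u, real_inner_comm g v,
    real_inner_comm ls (A u), real_inner_comm ls (A v), real_inner_comm ν (A u),
    real_inner_comm ν (A v), real_inner_comm (A u) (A v)]
  ring

end PrimalDual

theorem ergodic_objective_rate
    {n m : ℕ}
    (f : EuclideanSpace ℝ (Fin n) → ℝ)
    (hf_conv : ConvexOn ℝ Set.univ f)
    (hf_smooth : ContDiff ℝ 1 f)
    (A : EuclideanSpace ℝ (Fin n) →L[ℝ] EuclideanSpace ℝ (Fin m))
    (b : EuclideanSpace ℝ (Fin m))
    (t₀ γ δ σ : ℝ) (ht₀ : 0 ≤ t₀) (hγ : 0 < γ) (hδ : 0 < δ) (hσ : 0 < σ)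
    (β : ℝ) (hβpos : 0 < β) (hγδ : 1 < γ * δ)
    (xs : EuclideanSpace ℝ (Fin n)) (ls : EuclideanSpace ℝ (Fin m))
    (hsaddle : IsSaddlePoint f A b xs ls)
    (x x' x'' : ℝ → EuclideanSpace ℝ (Fin n))
    (lam lam' : ℝ → EuclideanSpace ℝ (Fin m))
    (hx : ∀ t ∈ Ici t₀, HasDerivWithinAt x (x' t) (Ici t₀) t)
    (hx' : ∀ t ∈ Ici t₀, HasDerivWithinAt x' (x'' t) (Ici t₀) t)
    (hx''cont : ContinuousOn x'' (Ici t₀))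
    (hlam : ∀ t ∈ Ici t₀, HasDerivWithinAt lam (lam' t) (Ici t₀) t)
    (hlam'cont : ContinuousOn lam' (Ici t₀))
    (hode1 : ∀ t ∈ Ici t₀, x'' t + γ • x' t =
      -β • (gradient f (x t) + A.adjoint (lam t) + σ • A.adjoint (A (x t) - b)))
    (hode2 : ∀ t ∈ Ici t₀, lam' t = β • (A (x t + δ • x' t) - b))
    (xbar : ℝ → EuclideanSpace ℝ (Fin n))
    (hxbar : ∀ t, t₀ < t → xbar t = (1 / (t - t₀)) • ∫ s in t₀..t, x s)
    :
    ∃ C T : ℝ, 0 ≤ C ∧ t₀ < T ∧ ∀ t ≥ T, |f (xbar t) - f xs| ≤ C / t := by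
  have hA := hsaddle.map_eq
  have hgrad : ∀ y, HasGradientAt f (gradient f y) y := fun y =>
    (hf_smooth.differentiable one_ne_zero y).hasGradientAt
  have hconv := fun z y => hf_conv.add_inner_gradient_le (hgrad z) y
  have hγδ' : 0 < γ * δ - 1 := by linarith
  have ht₀mem : t₀ ∈ Ici t₀ := self_mem_Ici
  set E : ℝ → ℝ := fun t => lyapunov f A b γ δ σ β xs ls (x t) (x' t) (lam t)
  have hElyap : ∀ t, E t = lyapunov f A b γ δ σ β xs ls (x t) (x' t) (lam t) := fun _ => rfl
  have hEderiv := fun t ht => hasDerivWithinAt_lyapunov (ls := ls) hA (hgrad (x t)) (hx t ht)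
    (hx' t ht) (hlam t ht) (hode1 t ht) (hode2 t ht)
  have hdecay : ∀ t, -(δ * (γ * δ - 1)) * ‖x' t‖ ^ 2
      - δ * β * (⟪gradient f (x t), x t - xs⟫ + ⟪ls, A (x t) - b⟫ + σ * ‖A (x t) - b‖ ^ 2)
      ≤ -(δ * β * (Lagr f A b (x t) ls - f xs)) := fun t => by
    have h1 := hconv (x t) xs
    rw [← neg_sub (x t) xs, inner_neg_right] at h1
    have h2 : 0 ≤ δ * (γ * δ - 1) * ‖x' t‖ ^ 2 := by positivity
    have h3 : 0 ≤ σ * ‖A (x t) - b‖ ^ 2 := by positivity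
    have h4 : Lagr f A b (x t) ls - f xs ≤
        ⟪gradient f (x t), x t - xs⟫ + ⟪ls, A (x t) - b⟫ + σ * ‖A (x t) - b‖ ^ 2 := by
      unfold Lagr; linarith
    have h5 := mul_le_mul_of_nonneg_left h4 (by positivity : 0 ≤ δ * β)
    linarith
  have hEanti : AntitoneOn E (Ici t₀) :=
    antitoneOn_Ici_of_hasDerivWithinAt_nonpos hEderiv fun t _ => (hdecay t).trans <|
      neg_nonpos.2 <| mul_nonneg (by positivity) (sub_nonneg.2 (hsaddle.le_lagr _))
  have hAug : ∀ t, 0 ≤ δ ^ 2 * β * (AugLagr f A b σ (x t) ls - f xs) := fun t => by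
    have h1 := hsaddle.le_lagr (x t)
    have h2 : 0 ≤ σ / 2 * ‖A (x t) - b‖ ^ 2 := by positivity
    refine mul_nonneg (by positivity) ?_
    unfold AugLagr; linarith
  have hEnonneg : ∀ t, 0 ≤ E t := fun t => by
    have := hAug t
    rw [hElyap, lyapunov]
    positivity
  have hxbound : ∀ t ∈ Ici t₀, ‖x t - xs‖ ≤ √(2 * E t₀ / (γ * δ - 1)) := fun t ht => by
    refine Real.le_sqrt_of_sq_le ?_
    rw [le_div_iff₀ hγδ']
    have h1 := hEanti ht₀mem ht ht
    have h2 := hAug t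
    have h3 : 0 ≤ δ / 2 * ‖lam t - ls‖ ^ 2 := by positivity
    have h4 := sq_nonneg ‖x t - xs + δ • x' t‖
    have h5 := hElyap t
    simp only [lyapunov] at h5
    linarith
  have hlambound : ∀ t ∈ Ici t₀, ‖lam t - ls‖ ≤ √(2 * E t₀ / δ) := fun t ht => by
    refine Real.le_sqrt_of_sq_le ?_
    rw [le_div_iff₀ hδ]
    have h1 := hEanti ht₀mem ht ht
    have h2 := hAug t
    have h3 : 0 ≤ (γ * δ - 1) / 2 * ‖x t - xs‖ ^ 2 := by positivity
    have h4 := sq_nonneg ‖x t - xs + δ • x' t‖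
    have h5 := hElyap t
    simp only [lyapunov] at h5
    linarith
  have hX := fun t ht => ContinuousOn.hasDerivWithinAt_integral_Ici
    (fun s hs => (hx s hs).continuousWithinAt) (t := t) (a := t₀) ht
  set X : ℝ → EuclideanSpace ℝ (Fin n) := fun t => ∫ s in t₀..t, x s
  have hX₀ : X t₀ = 0 := intervalIntegral.integral_same
  have hXbar : ∀ t, t₀ < t → X t = (t - t₀) • xbar t := fun t ht => by
    rw [hxbar t ht, smul_smul, mul_one_div_cancel (sub_pos.2 ht).ne', one_smul]
  have hgap : ∀ t, t₀ < t → δ * β * ((t - t₀) * (Lagr f A b (xbar t) ls - f xs)) ≤ E t₀ := by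
    intro t ht
    set y := xbar t with hy
    set q := gradient f y + A.adjoint ls with hq
    have hsub : ∀ z, Lagr f A b y ls + ⟪q, z - y⟫ ≤ Lagr f A b z ls := fun z => by
      have h1 := hconv y z
      simp only [hq, Lagr, inner_add_left, ContinuousLinearMap.adjoint_inner_left,
        inner_sub_right] at h1 ⊢
      linarith
    have hderiv : ∀ s ∈ Ici t₀, HasDerivWithinAt
        (fun s => E s + δ * β * ((s - t₀) * (Lagr f A b y ls - ⟪q, y⟫ - f xs) + ⟪q, X s⟫))
        _ (Ici t₀) s := fun s hs =>
      (hEderiv s hs).add (((((hasDerivWithinAt_id s (Ici t₀)).sub_const t₀).mul_const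
        (Lagr f A b y ls - ⟪q, y⟫ - f xs)).add
        ((hasDerivWithinAt_const s (Ici t₀) q).inner ℝ (hX s hs))).const_mul (δ * β))
    have h := antitoneOn_Ici_of_hasDerivWithinAt_nonpos hderiv (fun s _ => by
      have h1 := hdecay s
      have h2 := mul_le_mul_of_nonneg_left (hsub (x s)) (by positivity : 0 ≤ δ * β)
      rw [inner_sub_right] at h2
      rw [inner_zero_left]
      linarith) ht₀mem ht.le ht.le
    simp only [hX₀, hXbar t ht, ← hy, inner_smul_right, inner_zero_right, sub_self] at h
    linarith [hEnonneg t]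
  have hconst : ∀ t ∈ Ici t₀, (t - t₀) • b - A (X t) =
      δ • A (x t - x t₀) - β⁻¹ • (lam t - lam t₀) := by
    intro t ht
    have hderiv : ∀ s ∈ Ici t₀, HasDerivWithinAt
        (fun s => (s - t₀) • b - A (X s) - δ • A (x s) + β⁻¹ • lam s) 0 (Ici t₀) s := by
      intro s hs
      have h := (((((hasDerivWithinAt_id s (Ici t₀)).sub_const t₀).smul_const b).sub
        (A.hasFDerivAt.comp_hasDerivWithinAt s (hX s hs))).sub
        ((A.hasFDerivAt.comp_hasDerivWithinAt s (hx s hs)).const_smul δ)).add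
        ((hlam s hs).const_smul β⁻¹)
      refine h.congr_deriv ?_
      rw [hode2 s hs, smul_smul, inv_mul_cancel₀ hβpos.ne', map_add, map_smul]
      module
    have h := (convex_Ici t₀).norm_image_sub_le_of_norm_hasDerivWithin_le hderiv
      (fun s _ => norm_zero.le) ht₀mem ht
    rw [zero_mul, norm_le_zero_iff, hX₀, sub_self, zero_smul, map_zero] at h
    rw [map_sub, ← sub_eq_zero, ← h]
    module
  set M := √(2 * E t₀ / (γ * δ - 1))
  set N := √(2 * E t₀ / δ)
  set K := δ * (‖A‖ * (2 * M)) + β⁻¹ * (2 * N)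
  have hfeas : ∀ t, t₀ < t → (t - t₀) * ‖A (xbar t) - b‖ ≤ K := by
    intro t ht
    have hx2 : ‖x t - x t₀‖ ≤ 2 * M := by
      rw [← sub_sub_sub_cancel_right (x t) (x t₀) xs]
      linarith [norm_sub_le (x t - xs) (x t₀ - xs), hxbound t ht.le, hxbound t₀ ht₀mem]
    have hl2 : ‖lam t - lam t₀‖ ≤ 2 * N := by
      rw [← sub_sub_sub_cancel_right (lam t) (lam t₀) ls]
      linarith [norm_sub_le (lam t - ls) (lam t₀ - ls), hlambound t ht.le, hlambound t₀ ht₀mem]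
    calc (t - t₀) * ‖A (xbar t) - b‖ = ‖(t - t₀) • b - A (X t)‖ := by
          rw [hXbar t ht, map_smul, ← smul_sub, norm_smul, Real.norm_of_nonneg (sub_pos.2 ht).le,
            norm_sub_rev]
      _ ≤ ‖δ • A (x t - x t₀)‖ + ‖β⁻¹ • (lam t - lam t₀)‖ := by
          rw [hconst t ht.le]; exact norm_sub_le _ _
      _ = δ * ‖A (x t - x t₀)‖ + β⁻¹ * ‖lam t - lam t₀‖ := by
          rw [norm_smul, norm_smul, Real.norm_of_nonneg hδ.le,
            Real.norm_of_nonneg (inv_nonneg.2 hβpos.le)]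
      _ ≤ K := by
          exact add_le_add (mul_le_mul_of_nonneg_left (A.le_opNorm_of_le hx2) hδ.le)
            (mul_le_mul_of_nonneg_left hl2 (inv_nonneg.2 hβpos.le))
  have hrate : ∀ t, t₀ < t →
      (t - t₀) * |f (xbar t) - f xs| ≤ E t₀ / (δ * β) + ‖ls‖ * K := by
    intro t ht
    have hpos : 0 < t - t₀ := sub_pos.2 ht
    have h0 := hsaddle.le_lagr (xbar t)
    have h1 : (t - t₀) * (Lagr f A b (xbar t) ls - f xs) ≤ E t₀ / (δ * β) := by
      rw [le_div_iff₀' (by positivity)]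
      exact hgap t ht
    have h2 : |f (xbar t) - f xs| ≤
        (Lagr f A b (xbar t) ls - f xs) + ‖ls‖ * ‖A (xbar t) - b‖ := by
      have h3 := abs_le.1 (abs_real_inner_le_norm ls (A (xbar t) - b))
      rw [abs_le]
      unfold Lagr at h0 ⊢
      constructor <;> linarith
    have h4 := mul_le_mul_of_nonneg_left h2 hpos.le
    have h5 := mul_le_mul_of_nonneg_left (hfeas t ht) (norm_nonneg ls)
    linarith
  have hK : 0 ≤ K := by positivity
  have hC : 0 ≤ E t₀ / (δ * β) + ‖ls‖ * K := by
    have := hEnonneg t₀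
    positivity
  refine ⟨2 * (E t₀ / (δ * β) + ‖ls‖ * K), 2 * t₀ + 1, by positivity, by linarith, fun t ht => ?_⟩
  rw [le_div_iff₀ (by linarith)]
  have h1 := hrate t (by linarith)
  have h2 := mul_le_mul_of_nonneg_right (by linarith : t ≤ 2 * (t - t₀))
    (abs_nonneg (f (xbar t) - f xs))
  linarith
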